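/- Let T_i (i=1,…,n-1) act on Laurent polynomials by the Demazure–Lusztig formula T_i = t^{-1/2} x_{i+1} ∂_i - t^{1/2} ∂_i x_{i+1}, with ∂_i f = (f - s_i f)/(x_i - x_{i+1}), and let 1_0 = ∑_{w∈S_n} t^{(ℓ(w)-ℓ(w_0))/2} T_w (T_w = T_{i_1}⋯T_{i_ℓ} for any reduced word of w). Then for every Laurent polynomial f, 1_0 f = t^{-ℓ(w_0)/2} ∑_{w∈S_n} w·( f · ∏_{1≤i<j≤n} (x_i - t x_j)/(x_i - x_j) ) whenever f is symmetric—in particular T_i(1_0 f) = t^{1/2}(1_0 f) for all i, so 1_0 maps ℂ[X] onto the symmetric Laurent polynomials. -/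

import Mathlib

noncomputable section

open MvPolynomial Finset

/-- The field of rational functions `ℂ(t^{1/2})(x_1,…,x_n)` (with rational coefficient
field; `t^{1/2}` is the generator of `RatFunc ℚ`, and `t = (t^{1/2})²`). -/
abbrev KK (n : ℕ) := FractionRing (MvPolynomial (Fin n) (RatFunc ℚ))

/-- The element `t^{1/2}`. -/
def tHalf (n : ℕ) : KK n :=
  algebraMap (MvPolynomial (Fin n) (RatFunc ℚ)) (KK n) (C RatFunc.X)

/-- The variable `x_i`. -/
def xv {n : ℕ} (i : Fin n) : KK n :=
  algebraMap (MvPolynomial (Fin n) (RatFunc ℚ)) (KK n) (X i)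

/-- The action of `w ∈ S_n` on rational functions, permuting the variables. -/
def sAct {n : ℕ} (w : Equiv.Perm (Fin n)) : KK n →+* KK n :=
  IsFractionRing.lift
    (g := (algebraMap (MvPolynomial (Fin n) (RatFunc ℚ)) (KK n)).comp
      (rename (w : Fin n → Fin n) :
        MvPolynomial (Fin n) (RatFunc ℚ) →ₐ[RatFunc ℚ] MvPolynomial (Fin n) (RatFunc ℚ)).toRingHom)
    (by
      intro a b hab
      exact rename_injective (w : Fin n → Fin n) w.injective
        (IsFractionRing.injective (MvPolynomial (Fin n) (RatFunc ℚ)) (KK n) (by simpa using hab)))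

/-- The divided difference operator `∂_i f = (f - s_i f)/(x_i - x_{i+1})` (with `j = i+1`). -/
def divDiff {n : ℕ} (i j : Fin n) : KK n → KK n := fun f =>
  (f - sAct (Equiv.swap i j) f) / (xv i - xv j)

/-- The Demazure–Lusztig operator `T_i = t^{-1/2} x_{i+1} ∂_i - t^{1/2} ∂_i x_{i+1}`
(with `j = i+1`). -/
def heckeT {n : ℕ} (i j : Fin n) : KK n → KK n := fun f =>
  (tHalf n)⁻¹ * (xv j * divDiff i j f) - tHalf n * divDiff i j (xv j * f)

/-- The length (number of inversions) of a permutation of `Fin n`. -/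
def permLength {n : ℕ} (w : Equiv.Perm (Fin n)) : ℕ :=
  (Finset.univ.filter fun p : Fin n × Fin n => p.1 < p.2 ∧ w p.2 < w p.1).card

/-- The symmetrizer `1_0 = ∑_{w ∈ S_n} t^{(ℓ(w) - ℓ(w_0))/2} T_w`, where `T_w` is the
well-defined product of `T_i`'s along a reduced word for `w` (given as the data `Tw`). -/
def one0 {n : ℕ} (Tw : Equiv.Perm (Fin n) → KK n → KK n) (f : KK n) : KK n :=
  ∑ w : Equiv.Perm (Fin n),
    tHalf n ^ ((permLength w : ℤ) - (n * (n - 1) / 2 : ℕ)) * Tw w f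

/-- The set of Laurent polynomials inside `KK n`: quotients of a polynomial by a
monomial in the `x_i`. -/
def LaurentSet (n : ℕ) : Set (KK n) :=
  {f | ∃ (p : MvPolynomial (Fin n) (RatFunc ℚ)) (m : Fin n → ℕ),
    f = algebraMap (MvPolynomial (Fin n) (RatFunc ℚ)) (KK n) p * (∏ i, xv i ^ m i)⁻¹}

/-! ### Combinatorial identities -/

theorem aux_prod_pairs_succ {K : Type*} [CommMonoid K] (m : ℕ) (g : Fin (m+1) → Fin (m+1) → K) :
    (∏ i, ∏ j, if i < j then g i j else 1)
      = (∏ j : Fin m, g 0 j.succ) *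
        ∏ i : Fin m, ∏ j : Fin m, if i < j then g i.succ j.succ else 1 := by
  rw [Fin.prod_univ_succ]
  congr 1
  · rw [Fin.prod_univ_succ]; simp
  · refine Finset.prod_congr rfl fun i _ => ?_
    rw [Fin.prod_univ_succ]; simp

theorem aux_sum_perm {K ι : Type*} [CommRing K] (c : ι → ι → K) (G : ℕ → K)
    (H : ∀ (m : ℕ) (y : Fin m → ι), Function.Injective y →
      ∑ k, ∏ j ∈ univ.erase k, c (y k) (y j) = G m) :
    ∀ (m : ℕ) (y : Fin m → ι), Function.Injective y →
      ∑ w : Equiv.Perm (Fin m), (∏ i, ∏ j, if i < j then c (y (w i)) (y (w j)) else 1)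
        = ∏ k ∈ range m, G (k + 1) := by
  intro m
  induction m with
  | zero => intro y _; simp
  | succ m ih =>
    intro y hy
    rw [Finset.prod_range_succ, ← H (m+1) y hy, Finset.mul_sum,
      ← Equiv.sum_comp Equiv.Perm.decomposeFin.symm, Fintype.sum_prod_type]
    refine Finset.sum_congr rfl fun p _ => ?_
    have hy' : Function.Injective (fun i : Fin m => y (Equiv.swap 0 p i.succ)) :=
      hy.comp ((Equiv.swap 0 p).injective.comp (Fin.succ_injective m))
    rw [← ih _ hy', Finset.sum_mul]
    refine Finset.sum_congr rfl fun e _ => ?_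
    rw [aux_prod_pairs_succ, mul_comm]
    simp only [Equiv.Perm.decomposeFin_symm_apply_zero, Equiv.Perm.decomposeFin_symm_apply_succ]
    congr 1
    rw [Equiv.prod_comp e (fun j => c (y p) (y (Equiv.swap 0 p j.succ)))]
    symm
    have h1 : (univ.erase p : Finset (Fin (m+1)))
        = (univ : Finset (Fin m)).image (fun j => Equiv.swap 0 p j.succ) := by
      ext k
      simp only [mem_erase, mem_univ, and_true, mem_image, true_and]
      constructor
      · intro hk
        have : Equiv.swap 0 p k ≠ 0 := by
          intro h
          apply hk
          have := congrArg (Equiv.swap 0 p) h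
          simpa using this
        obtain ⟨j, hj⟩ := Fin.exists_succ_eq.2 this
        exact ⟨j, by rw [hj]; simp⟩
      · rintro ⟨j, rfl⟩ h
        have := congrArg (Equiv.swap 0 p) h
        simp at this
    rw [h1, Finset.prod_image]
    intro a _ b _ hab
    exact Fin.succ_injective _ ((Equiv.swap 0 p).injective hab)

theorem aux_H_lagrange {K : Type*} [Field K] (t : K) (ht : t ≠ 1) (m : ℕ) (x : Fin m → K)
    (hx : Function.Injective x) (hx0 : ∀ i, x i ≠ 0) :
    ∑ k, ∏ j ∈ univ.erase k, ((x k - t * x j) / (x k - x j)) = ∑ k ∈ range m, t ^ k := by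
  have ht' : (1 - t) ≠ 0 := sub_ne_zero.2 (Ne.symm ht)
  let v : Option (Fin m) → K := fun o => o.elim 0 x
  have hv : Function.Injective v := by
    rintro (_ | a) (_ | b) h
    · rfl
    · exact absurd h.symm (hx0 b)
    · exact absurd h (hx0 a)
    · exact congrArg some (hx h)
  let P : Polynomial K := ∏ j : Fin m, (Polynomial.X - Polynomial.C (t * x j))
  have hPm : P.Monic := Polynomial.monic_prod_of_monic _ _ fun j _ => Polynomial.monic_X_sub_C _
  have hdeg : P.degree = m := by
    simp only [P, Polynomial.degree_prod, Polynomial.degree_X_sub_C]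
    simp
  have key := Lagrange.leadingCoeff_eq_sum (s := (univ : Finset (Option (Fin m)))) (v := v)
    hv.injOn (P := P) (by rw [hdeg]; simp)
  rw [hPm.leadingCoeff, Fintype.sum_option] at key
  have e0 : (univ.erase (none : Option (Fin m))) = (univ : Finset (Fin m)).image some := by
    ext o; cases o <;> simp
  have es : ∀ k : Fin m, (univ.erase (some k : Option (Fin m)))
      = insert none ((univ.erase k).image some) := by
    intro k; ext o; cases o <;> simp
  have hP : ∀ z, P.eval z = ∏ j, (z - t * x j) := by
    intro z; simp [P, Polynomial.eval_prod]
  have h0 : P.eval (v none) / ∏ j ∈ univ.erase none, (v none - v j) = t ^ m := by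
    rw [e0, Finset.prod_image (by intro a _ b _ h; exact Option.some_injective _ h), hP,
      ← Finset.prod_div_distrib]
    rw [Finset.prod_congr rfl (g := fun _ => t)]
    · simp
    · intro j _
      have := hx0 j
      simp only [v, Option.elim]
      field_simp
      simp
  have hs : ∀ k : Fin m, P.eval (v (some k)) / ∏ j ∈ univ.erase (some k), (v (some k) - v j)
      = (1 - t) * ∏ j ∈ univ.erase k, ((x k - t * x j) / (x k - x j)) := by
    intro k
    rw [es k, Finset.prod_insert (by simp),
      Finset.prod_image (by intro a _ b _ h; exact Option.some_injective _ h), hP,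
      ← Finset.mul_prod_erase univ _ (mem_univ k), Finset.prod_div_distrib]
    have := hx0 k
    simp only [v, Option.elim]
    rw [mul_div_mul_comm]
    congr 1
    field_simp
    simp
  rw [h0, Finset.sum_congr rfl (fun k _ => hs k), ← Finset.mul_sum] at key
  apply mul_left_cancel₀ ht'
  rw [mul_neg_geom_sum]
  linear_combination -key

theorem aux_H_count {K ι : Type*} [CommRing K] [LinearOrder ι] (t : K) (m : ℕ) (y : Fin m → ι)
    (hy : Function.Injective y) :
    ∑ k, ∏ j ∈ univ.erase k, (if y j < y k then t else 1) = ∑ k ∈ range m, t ^ k := by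
  have h1 : ∀ k, ∏ j ∈ univ.erase k, (if y j < y k then t else 1)
      = t ^ (univ.filter fun j => y j < y k).card := by
    intro k
    rw [← Finset.prod_const, Finset.prod_filter]
    rw [← Finset.mul_prod_erase univ _ (mem_univ k)]
    simp
  have hlt : ∀ k, (univ.filter fun j => y j < y k).card < m := by
    intro k
    calc _ < (univ : Finset (Fin m)).card := by
          apply Finset.card_lt_card
          rw [Finset.ssubset_iff_of_subset (subset_univ _)]
          exact ⟨k, mem_univ _, by simp⟩
      _ = m := by simp
  have hmono : ∀ k l, y k < y l →
      (univ.filter fun j => y j < y k).card < (univ.filter fun j => y j < y l).card := by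
    intro k l hkl
    apply Finset.card_lt_card
    rw [Finset.ssubset_iff_of_subset]
    · exact ⟨k, by simpa using hkl, by simp⟩
    · intro j hj
      simp only [mem_filter, mem_univ, true_and] at hj ⊢
      exact hj.trans hkl
  let φ : Fin m → Fin m := fun k => ⟨_, hlt k⟩
  have hφ : Function.Injective φ := by
    intro k l h
    have h' : (univ.filter fun j => y j < y k).card = (univ.filter fun j => y j < y l).card :=
      congrArg Fin.val h
    rcases lt_trichotomy (y k) (y l) with h2 | h2 | h2
    · exact absurd h' (hmono _ _ h2).ne
    · exact hy h2
    · exact absurd h' (hmono _ _ h2).ne'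
  rw [Finset.sum_congr rfl (fun k _ => h1 k), Finset.sum_range]
  exact (Finite.injective_iff_bijective.1 hφ).sum_comp (fun k : Fin m => t ^ (k : ℕ))

theorem aux_pow_permLength {K : Type*} [CommRing K] (t : K) {n : ℕ} (w : Equiv.Perm (Fin n)) :
    (∏ i, ∏ j, if i < j then (if w j < w i then t else 1) else 1) = t ^ permLength w := by
  rw [permLength, ← Finset.prod_const, Finset.prod_filter, Fintype.prod_prod_type]
  refine Finset.prod_congr rfl fun i _ => Finset.prod_congr rfl fun j _ => ?_
  by_cases h : i < j <;> simp [h]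

theorem aux_macdonald {K : Type*} [Field K] (t : K) (ht : t ≠ 1) (n : ℕ) (x : Fin n → K)
    (hx : Function.Injective x) (hx0 : ∀ i, x i ≠ 0) :
    ∑ w : Equiv.Perm (Fin n), (∏ i, ∏ j, if i < j then
        ((x (w i) - t * x (w j)) / (x (w i) - x (w j))) else 1)
      = ∑ w : Equiv.Perm (Fin n), t ^ permLength w := by
  have A := aux_sum_perm (fun a b => (x a - t * x b) / (x a - x b))
    (fun m => ∑ k ∈ range m, t ^ k)
    (fun m y hy => aux_H_lagrange t ht m (x ∘ y) (hx.comp hy) (fun i => hx0 _)) n id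
    Function.injective_id
  have B := aux_sum_perm (fun a b : Fin n => if b < a then t else 1)
    (fun m => ∑ k ∈ range m, t ^ k)
    (fun m y hy => aux_H_count t m y hy) n id Function.injective_id
  simp only [id] at A B
  rw [A, ← B]
  exact Finset.sum_congr rfl fun w _ => aux_pow_permLength t w

/-! ### Lengths -/

theorem aux_length_step {n : ℕ} (w : Equiv.Perm (Fin n)) (i j : Fin n)
    (hij : (i : ℕ) + 1 = (j : ℕ)) (h : w.symm i < w.symm j) :
    permLength (Equiv.swap i j * w) = permLength w + 1 := by
  have hne : i ≠ j := by rintro rfl; omega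
  unfold permLength
  rw [← Finset.card_insert_of_notMem (a := (w.symm i, w.symm j))
    (s := univ.filter fun p : Fin n × Fin n => p.1 < p.2 ∧ w p.2 < w p.1)]
  · congr 1
    ext ⟨a, b⟩
    rw [mem_insert, mem_filter, mem_filter]
    simp only [mem_univ, true_and, Prod.mk.injEq, Equiv.Perm.coe_mul, Function.comp_apply]
    obtain ⟨a', rfl⟩ := w.symm.surjective a
    obtain ⟨b', rfl⟩ := w.symm.surjective b
    simp only [Equiv.apply_symm_apply, EmbeddingLike.apply_eq_iff_eq]
    by_cases hab : a' = b'
    · subst hab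
      simp only [lt_self_iff_false, false_and, or_false, false_iff]
      rintro ⟨rfl, rfl⟩; exact hne rfl
    by_cases ha : a' = i
    · subst ha
      by_cases hb : b' = j
      · subst hb
        have : a' < b' := Fin.lt_def.2 (by omega)
        simp [h, this]
      · have hb2 : b' ≠ a' := Ne.symm hab
        rw [Equiv.swap_apply_left, Equiv.swap_apply_of_ne_of_ne hb2 hb]
        simp only [hb, and_false, false_or, Fin.lt_def]
        have : (b' : ℕ) ≠ j := fun h => hb (Fin.ext h)
        have : (b' : ℕ) ≠ a' := fun h => hb2 (Fin.ext h)
        omega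
    · by_cases ha2 : a' = j
      · subst ha2
        rw [Equiv.swap_apply_right]
        by_cases hb : b' = i
        · subst hb
          simp [ha, not_lt.2 h.le]
        · rw [Equiv.swap_apply_of_ne_of_ne hb (Ne.symm hab)]
          simp only [ha, false_and, false_or, Fin.lt_def]
          have : (b' : ℕ) ≠ i := fun h => hb (Fin.ext h)
          have : (b' : ℕ) ≠ a' := fun h => hab (Fin.ext h.symm)
          omega
      · rw [Equiv.swap_apply_of_ne_of_ne ha ha2]
        simp only [ha, false_and, false_or]
        have h1 : (a' : ℕ) ≠ i := fun h => ha (Fin.ext h)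
        have h2 : (a' : ℕ) ≠ j := fun h => ha2 (Fin.ext h)
        by_cases hb : b' = i
        · subst hb
          rw [Equiv.swap_apply_left]
          simp only [Fin.lt_def]
          omega
        by_cases hb2 : b' = j
        · subst hb2
          rw [Equiv.swap_apply_right]
          simp only [Fin.lt_def]
          omega
        rw [Equiv.swap_apply_of_ne_of_ne hb hb2]
  · have : i < j := Fin.lt_def.2 (by omega)
    simp [this.le]

theorem aux_swap_swap {n : ℕ} (w : Equiv.Perm (Fin n)) (i j : Fin n) :
    Equiv.swap i j * (Equiv.swap i j * w) = w := by
  rw [← mul_assoc, Equiv.swap_mul_self, one_mul]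

/-- Left-descent dichotomy. -/
theorem aux_length_dich {n : ℕ} (w : Equiv.Perm (Fin n)) (i j : Fin n)
    (hij : (i : ℕ) + 1 = (j : ℕ)) :
    permLength (Equiv.swap i j * w) = permLength w + 1 ∨
    permLength w = permLength (Equiv.swap i j * w) + 1 := by
  have hne : i ≠ j := by rintro rfl; omega
  rcases lt_trichotomy (w.symm i) (w.symm j) with h | h | h
  · exact Or.inl (aux_length_step w i j hij h)
  · exact absurd (w.symm.injective h) hne
  · right
    have := aux_length_step (Equiv.swap i j * w) i j hij (by
      have e : ∀ k, (Equiv.swap i j * w).symm k = w.symm (Equiv.swap i j k) := by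
        intro k
        rw [Equiv.symm_apply_eq]
        simp
      rw [e, e]; simpa using h)
    rwa [aux_swap_swap] at this

theorem aux_perm_induction {n : ℕ} {P : Equiv.Perm (Fin n) → Prop} (h1 : P 1)
    (hs : ∀ (w : Equiv.Perm (Fin n)) (i j : Fin n), (i : ℕ) + 1 = (j : ℕ) →
      permLength (Equiv.swap i j * w) = permLength w + 1 → P w → P (Equiv.swap i j * w)) :
    ∀ w, P w := by
  suffices ∀ (k : ℕ) (w : Equiv.Perm (Fin n)), permLength w = k → P w from fun w => this _ w rfl
  intro k
  induction k using Nat.strong_induction_on with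
  | _ k ih =>
    intro w hw
    by_cases hd : ∃ i j : Fin n, (i : ℕ) + 1 = j ∧
        permLength w = permLength (Equiv.swap i j * w) + 1
    · obtain ⟨i, j, hij, hl⟩ := hd
      have := hs (Equiv.swap i j * w) i j hij (by rw [aux_swap_swap]; exact hl)
        (ih _ (by omega) _ rfl)
      rwa [aux_swap_swap] at this
    · push Not at hd
      have hmono : ∀ i j : Fin n, (i : ℕ) + 1 = j → w.symm i < w.symm j := by
        intro i j hij
        have hne : i ≠ j := by rintro rfl; omega
        by_contra hcon
        have hcon : w.symm j < w.symm i :=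
          lt_of_le_of_ne (not_lt.1 hcon) (fun h => hne (w.symm.injective h).symm)
        apply hd i j hij
        have := aux_length_step (Equiv.swap i j * w) i j hij (by
          have e : ∀ k, (Equiv.swap i j * w).symm k = w.symm (Equiv.swap i j k) := by
            intro k
            rw [Equiv.symm_apply_eq]
            simp
          rw [e, e]; simpa using hcon)
        rwa [aux_swap_swap] at this
      have hsm : StrictMono w.symm := by
        cases n with
        | zero => intro a; exact a.elim0
        | succ n =>
          rw [Fin.strictMono_iff_lt_succ]
          intro i
          exact hmono _ _ (by simp)
      have hid : ⇑w.symm = id := hsm.eq_id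
      have : w = 1 := by
        ext a
        have h2 : w.symm a = a := congrFun hid a
        rw [Equiv.symm_apply_eq] at h2
        rw [← h2]; rfl
      rw [this]; exact h1
/-! ### The action of permutations -/

theorem aux_alg_inj {n : ℕ} :
    Function.Injective (algebraMap (MvPolynomial (Fin n) (RatFunc ℚ)) (KK n)) :=
  IsFractionRing.injective _ _

theorem aux_sAct_alg {n : ℕ} (w : Equiv.Perm (Fin n)) (p : MvPolynomial (Fin n) (RatFunc ℚ)) :
    sAct w (algebraMap _ (KK n) p) = algebraMap _ (KK n) (rename w p) := by
  exact IsFractionRing.lift_algebraMap (K := KK n) _ p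

theorem aux_sAct_x {n : ℕ} (w : Equiv.Perm (Fin n)) (i : Fin n) :
    sAct w (xv i) = xv (w i) := by
  unfold xv
  rw [aux_sAct_alg, rename_X]

theorem aux_sAct_t {n : ℕ} (w : Equiv.Perm (Fin n)) : sAct w (tHalf n) = tHalf n := by
  unfold tHalf
  rw [aux_sAct_alg, rename_C]

theorem aux_sAct_one {n : ℕ} (f : KK n) : sAct 1 f = f := by
  obtain ⟨a, b, -, rfl⟩ := IsFractionRing.div_surjective (A := MvPolynomial (Fin n) (RatFunc ℚ)) f
  rw [map_div₀, aux_sAct_alg, aux_sAct_alg]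
  simp

theorem aux_sAct_mul {n : ℕ} (u v : Equiv.Perm (Fin n)) (f : KK n) :
    sAct (u * v) f = sAct u (sAct v f) := by
  obtain ⟨a, b, -, rfl⟩ := IsFractionRing.div_surjective (A := MvPolynomial (Fin n) (RatFunc ℚ)) f
  simp only [map_div₀, aux_sAct_alg, rename_rename]
  rfl

theorem aux_t_ne {n : ℕ} : tHalf n ≠ 0 := by
  unfold tHalf
  rw [Ne, map_eq_zero_iff _ aux_alg_inj, C_eq_zero]
  exact RatFunc.X_ne_zero

theorem aux_x_ne {n : ℕ} (i : Fin n) : xv i ≠ 0 := by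
  unfold xv
  rw [Ne, map_eq_zero_iff _ aux_alg_inj]
  exact X_ne_zero i

theorem aux_x_inj {n : ℕ} : Function.Injective (xv : Fin n → KK n) := by
  intro i j h
  exact X_injective (aux_alg_inj h)

theorem aux_poincare {n : ℕ} :
    ∃ c : RatFunc ℚ, c ≠ 0 ∧
      ∑ w : Equiv.Perm (Fin n), (tHalf n ^ 2) ^ permLength w
        = algebraMap (MvPolynomial (Fin n) (RatFunc ℚ)) (KK n) (C c) := by
  let P : Polynomial ℚ := ∑ w : Equiv.Perm (Fin n), (Polynomial.X ^ 2) ^ permLength w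
  refine ⟨algebraMap (Polynomial ℚ) (RatFunc ℚ) P, ?_, ?_⟩
  · rw [Ne, map_eq_zero_iff _ (IsFractionRing.injective _ _)]
    intro h
    have := congrArg (Polynomial.eval 1) h
    simp [P, Polynomial.eval_finsetSum] at this
  · simp [P, tHalf]

theorem aux_t_pow_ne {n : ℕ} (k : ℕ) (hk : k ≠ 0) : tHalf n ^ k ≠ 1 := by
  unfold tHalf
  intro h
  rw [← map_pow, ← map_pow, ← map_one (algebraMap (MvPolynomial (Fin n) (RatFunc ℚ)) (KK n))] at h
  have h2 := aux_alg_inj h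
  rw [← C_1] at h2
  have h3 := C_injective _ _ h2
  rw [← RatFunc.algebraMap_X, ← map_pow, ← map_one (algebraMap (Polynomial ℚ) (RatFunc ℚ))] at h3
  have h4 := IsFractionRing.injective (Polynomial ℚ) (RatFunc ℚ) h3
  have := congrArg (Polynomial.eval 0) h4
  simp [hk] at this

/-- The coefficient `t^{-1/2} x_j - t^{1/2} x_i` is nonzero. -/
theorem aux_coef_ne {n : ℕ} (i j : Fin n) (hne : i ≠ j) :
    (tHalf n)⁻¹ * xv j - tHalf n * xv i ≠ 0 := by
  intro h
  have ht := aux_t_ne (n := n)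
  have h1 : xv j = tHalf n ^ 2 * xv i := by
    field_simp at h
    linear_combination h
  have h2 := congrArg (sAct (Equiv.swap i j)) h1
  simp only [map_mul, map_pow, aux_sAct_x, aux_sAct_t, Equiv.swap_apply_left,
    Equiv.swap_apply_right] at h2
  have h3 : (tHalf n ^ 4 - 1) * xv i = 0 := by
    linear_combination (-(tHalf n ^ 2)) * h1 - h2
  rcases mul_eq_zero.1 h3 with h4 | h4
  · exact aux_t_pow_ne 4 (by norm_num) (sub_eq_zero.1 h4)
  · exact aux_x_ne i h4

/-! ### The operators -/

theorem aux_hecke_symm {n : ℕ} (i j : Fin n) (hne : i ≠ j) (f : KK n) :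
    heckeT i j f = tHalf n * f ↔ sAct (Equiv.swap i j) f = f := by
  have hx : (xv i - xv j : KK n) ≠ 0 := sub_ne_zero.2 fun h => hne (aux_x_inj h)
  have key : (xv i - xv j) * (heckeT i j f - tHalf n * f)
      = ((tHalf n)⁻¹ * xv j - tHalf n * xv i) * (f - sAct (Equiv.swap i j) f) := by
    simp only [heckeT, divDiff, map_mul, aux_sAct_x, Equiv.swap_apply_right]
    generalize (tHalf n)⁻¹ = q
    field_simp
    ring
  rw [← sub_eq_zero, ← mul_right_inj' hx, mul_zero, key, mul_eq_zero,
    or_iff_right (aux_coef_ne i j hne), sub_eq_zero, eq_comm]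

theorem aux_hecke_proj {n : ℕ} (i j : Fin n) (hne : i ≠ j) (f : KK n) :
    sAct (Equiv.swap i j) (f + tHalf n * heckeT i j f) = f + tHalf n * heckeT i j f := by
  have hx : (xv i - xv j : KK n) ≠ 0 := sub_ne_zero.2 fun h => hne (aux_x_inj h)
  have ht := aux_t_ne (n := n)
  have e : f + tHalf n * heckeT i j f = ((xv i - tHalf n ^ 2 * xv j) * f
      - (xv j - tHalf n ^ 2 * xv i) * sAct (Equiv.swap i j) f) / (xv i - xv j) := by
    simp only [heckeT, divDiff, map_mul, aux_sAct_x, Equiv.swap_apply_right]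
    field_simp
    ring
  have hss : sAct (Equiv.swap i j) (sAct (Equiv.swap i j) f) = f := by
    rw [← aux_sAct_mul, Equiv.swap_mul_self, aux_sAct_one]
  rw [e]
  simp only [map_div₀, map_sub, map_mul, map_pow, aux_sAct_x, aux_sAct_t, Equiv.swap_apply_left,
    Equiv.swap_apply_right, hss]
  rw [← neg_sub (xv i) (xv j), div_neg, ← neg_div]
  congr 1
  ring

theorem aux_symm_all {n : ℕ} (f : KK n)
    (h : ∀ i j : Fin n, (i : ℕ) + 1 = j → sAct (Equiv.swap i j) f = f) :
    ∀ w : Equiv.Perm (Fin n), sAct w f = f := by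
  apply aux_perm_induction
  · exact aux_sAct_one f
  · intro w i j hij _ hw
    rw [aux_sAct_mul, hw, h i j hij]

/-! ### Laurent polynomials -/

theorem aux_laurent_iff {n : ℕ} (f : KK n) : f ∈ LaurentSet n ↔
    ∃ N : ℕ, ∀ k, N ≤ k → ∃ p : MvPolynomial (Fin n) (RatFunc ℚ),
      (∏ i, xv i) ^ k * f = algebraMap _ (KK n) p := by
  constructor
  · rintro ⟨p, m, rfl⟩
    refine ⟨∑ i, m i, fun k hk => ⟨(∏ i, X i ^ (k - m i)) * p, ?_⟩⟩
    have hle : ∀ i, m i ≤ k := fun i =>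
      (Finset.single_le_sum (fun _ _ => Nat.zero_le _) (mem_univ i)).trans hk
    have h0 : (∏ i, xv i ^ m i : KK n) ≠ 0 :=
      Finset.prod_ne_zero_iff.2 fun i _ => pow_ne_zero _ (aux_x_ne i)
    have h1 : (∏ i, xv i : KK n) ^ k = (∏ i, xv i ^ (k - m i)) * ∏ i, xv i ^ m i := by
      rw [← Finset.prod_pow, ← Finset.prod_mul_distrib]
      refine Finset.prod_congr rfl fun i _ => ?_
      rw [← pow_add, Nat.sub_add_cancel (hle i)]
    have h2 : algebraMap (MvPolynomial (Fin n) (RatFunc ℚ)) (KK n) (∏ i, X i ^ (k - m i))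
        = ∏ i, xv i ^ (k - m i) := by
      simp [xv, map_prod]
    rw [h1, map_mul, h2]
    field_simp
  · rintro ⟨N, hN⟩
    obtain ⟨p, hp⟩ := hN N le_rfl
    refine ⟨p, fun _ => N, ?_⟩
    have h0 : (∏ i, xv i : KK n) ≠ 0 := Finset.prod_ne_zero_iff.2 fun i _ => aux_x_ne i
    rw [← hp, Finset.prod_pow]
    field_simp

theorem aux_laurent_add {n : ℕ} {f g : KK n} (hf : f ∈ LaurentSet n) (hg : g ∈ LaurentSet n) :
    f + g ∈ LaurentSet n := by
  rw [aux_laurent_iff] at *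
  obtain ⟨N, hN⟩ := hf
  obtain ⟨M, hM⟩ := hg
  refine ⟨max N M, fun k hk => ?_⟩
  obtain ⟨p, hp⟩ := hN k ((le_max_left _ _).trans hk)
  obtain ⟨q, hq⟩ := hM k ((le_max_right _ _).trans hk)
  exact ⟨p + q, by rw [mul_add, hp, hq, map_add]⟩

theorem aux_laurent_polymul {n : ℕ} {f : KK n} (p : MvPolynomial (Fin n) (RatFunc ℚ))
    (hf : f ∈ LaurentSet n) : algebraMap _ (KK n) p * f ∈ LaurentSet n := by
  obtain ⟨q, m, rfl⟩ := hf
  exact ⟨p * q, m, by rw [map_mul, mul_assoc]⟩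

theorem aux_laurent_sum {n : ℕ} {ι : Type*} (s : Finset ι) (F : ι → KK n)
    (h : ∀ a ∈ s, F a ∈ LaurentSet n) : ∑ a ∈ s, F a ∈ LaurentSet n := by
  classical
  induction s using Finset.induction_on with
  | empty => exact ⟨0, 0, by simp⟩
  | insert a s ha ih =>
    rw [Finset.sum_insert ha]
    exact aux_laurent_add (h a (mem_insert_self _ _))
      (ih fun b hb => h b (mem_insert_of_mem hb))

theorem aux_tpow {n : ℕ} (z : ℤ) :
    tHalf n ^ z = algebraMap (MvPolynomial (Fin n) (RatFunc ℚ)) (KK n) (C (RatFunc.X ^ z)) := by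
  have : ∀ c : RatFunc ℚ, algebraMap (MvPolynomial (Fin n) (RatFunc ℚ)) (KK n) (C c)
      = ((algebraMap (MvPolynomial (Fin n) (RatFunc ℚ)) (KK n)).comp C) c := fun _ => rfl
  unfold tHalf
  rw [this, this, map_zpow₀]

theorem aux_dvd {n : ℕ} (i j : Fin n) (p : MvPolynomial (Fin n) (RatFunc ℚ)) :
    (X i - X j) ∣ p - rename (Equiv.swap i j) p := by
  rw [← Ideal.mem_span_singleton, ← Ideal.Quotient.eq]
  have hij : Ideal.Quotient.mk (Ideal.span {(X i - X j : MvPolynomial (Fin n) (RatFunc ℚ))}) (X i)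
      = Ideal.Quotient.mk _ (X j) := by
    rw [Ideal.Quotient.eq]; exact Ideal.mem_span_singleton_self _
  have : (Ideal.Quotient.mk (Ideal.span {(X i - X j : MvPolynomial (Fin n) (RatFunc ℚ))}))
      = (Ideal.Quotient.mk _).comp (rename (Equiv.swap i j) :
        MvPolynomial (Fin n) (RatFunc ℚ) →ₐ[RatFunc ℚ] MvPolynomial (Fin n) (RatFunc ℚ)).toRingHom := by
    apply MvPolynomial.ringHom_ext
    · intro r
      simp
    · intro k
      simp only [AlgHom.toRingHom_eq_coe, RingHom.coe_comp, RingHom.coe_coe, Function.comp_apply,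
        rename_X]
      by_cases h1 : k = i
      · subst h1; rw [Equiv.swap_apply_left, hij]
      by_cases h2 : k = j
      · subst h2; rw [Equiv.swap_apply_right, hij]
      rw [Equiv.swap_apply_of_ne_of_ne h1 h2]
  exact congrArg (fun φ => φ p) this

theorem aux_laurent_divDiff {n : ℕ} (i j : Fin n) (hne : i ≠ j) {f : KK n}
    (hf : f ∈ LaurentSet n) : divDiff i j f ∈ LaurentSet n := by
  have hx : (xv i - xv j : KK n) ≠ 0 := sub_ne_zero.2 fun h => hne (aux_x_inj h)
  rw [aux_laurent_iff] at *
  obtain ⟨N, hN⟩ := hf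
  refine ⟨N, fun k hk => ?_⟩
  obtain ⟨p, hp⟩ := hN k hk
  obtain ⟨r, hr⟩ := aux_dvd i j p
  refine ⟨r, ?_⟩
  have hs := congrArg (sAct (Equiv.swap i j)) hp
  rw [map_mul, map_pow, map_prod, aux_sAct_alg] at hs
  simp only [aux_sAct_x] at hs
  rw [Equiv.prod_comp (Equiv.swap i j) (fun k => (xv k : KK n))] at hs
  have hr' := congrArg (algebraMap (MvPolynomial (Fin n) (RatFunc ℚ)) (KK n)) hr
  rw [map_sub, map_mul, map_sub, ← hp, ← hs] at hr'
  change _ = (xv i - xv j) * _ at hr'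
  unfold divDiff
  rw [← mul_div_assoc, div_eq_iff hx]
  linear_combination hr'

theorem aux_laurent_hecke {n : ℕ} (i j : Fin n) (hne : i ≠ j) {f : KK n}
    (hf : f ∈ LaurentSet n) : heckeT i j f ∈ LaurentSet n := by
  have h1 := aux_laurent_polymul (C (RatFunc.X ^ (-1 : ℤ)) * X j) (aux_laurent_divDiff i j hne hf)
  have h2 := aux_laurent_polymul (- C (RatFunc.X))
    (aux_laurent_divDiff i j hne (aux_laurent_polymul (X j) hf))
  have h3 := aux_laurent_add h1 h2
  rw [map_mul, ← aux_tpow, map_neg] at h3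
  have e : heckeT i j f = (tHalf n ^ (-1 : ℤ) * xv j) * divDiff i j f
      + (- tHalf n) * divDiff i j (xv j * f) := by
    rw [zpow_neg_one]
    simp only [heckeT]
    ring
  rw [e]
  exact h3

/-- Properties of the bosonic symmetrizer `1_0`:
(i) for a symmetric Laurent polynomial `f`,
`1_0 f = t^{-ℓ(w_0)/2} ∑_{w} w·(f · ∏_{i<j} (x_i - t x_j)/(x_i - x_j))`;
(ii) `T_i (1_0 f) = t^{1/2} (1_0 f)` for every `f` and every `i`;
(iii) the `t^{1/2}`-eigenspace of all `T_i` in the Laurent polynomials equals the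
symmetric Laurent polynomials, which is the image of the Laurent polynomials under `1_0`. -/
theorem symmetrizer_formula_and_image (n : ℕ)
    (Tw : Equiv.Perm (Fin n) → KK n → KK n)
    (hTw1 : Tw 1 = id)
    (hTwmul : ∀ (w : Equiv.Perm (Fin n)) (i j : Fin n), (i : ℕ) + 1 = (j : ℕ) →
      permLength (Equiv.swap i j * w) = permLength w + 1 →
      Tw (Equiv.swap i j * w) = heckeT i j ∘ Tw w) :
    (∀ f : KK n, f ∈ LaurentSet n → (∀ w : Equiv.Perm (Fin n), sAct w f = f) →
      one0 Tw f = tHalf n ^ (-(n * (n - 1) / 2 : ℕ) : ℤ) *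
        ∑ w : Equiv.Perm (Fin n),
          sAct w (f * ∏ p ∈ (Finset.univ.filter fun p : Fin n × Fin n => p.1 < p.2),
            (xv p.1 - tHalf n ^ 2 * xv p.2) / (xv p.1 - xv p.2)))
    ∧ (∀ f : KK n, ∀ i j : Fin n, (i : ℕ) + 1 = (j : ℕ) →
        heckeT i j (one0 Tw f) = tHalf n * one0 Tw f)
    ∧ ({f : KK n | f ∈ LaurentSet n ∧ ∀ i j : Fin n, (i : ℕ) + 1 = (j : ℕ) →
          heckeT i j f = tHalf n * f}
        = {f : KK n | f ∈ LaurentSet n ∧ ∀ w : Equiv.Perm (Fin n), sAct w f = f})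
    ∧ (one0 Tw '' LaurentSet n
        = {f : KK n | f ∈ LaurentSet n ∧ ∀ w : Equiv.Perm (Fin n), sAct w f = f}) := by
  have hne : ∀ i j : Fin n, (i : ℕ) + 1 = j → i ≠ j := by
    rintro i j h rfl; omega
  have hT : ∀ f : KK n, (∀ w : Equiv.Perm (Fin n), sAct w f = f) →
      ∀ w, Tw w f = tHalf n ^ permLength w * f := by
    intro f hf
    apply aux_perm_induction
    · rw [hTw1]
      have : permLength (1 : Equiv.Perm (Fin n)) = 0 := by
        unfold permLength
        rw [Finset.card_eq_zero, Finset.filter_eq_empty_iff]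
        rintro p _ ⟨h1, h2⟩
        exact lt_asymm h1 h2
      rw [this]; simp
    · intro w i j hij hl hw
      rw [hTwmul w i j hij hl, Function.comp_apply, hw, (aux_hecke_symm i j (hne i j hij) _).2,
        hl, pow_succ]
      · ring
      · rw [map_mul, map_pow, aux_sAct_t, hf]
  have hone : ∀ f : KK n, (∀ w : Equiv.Perm (Fin n), sAct w f = f) →
      one0 Tw f = tHalf n ^ (-(n * (n - 1) / 2 : ℕ) : ℤ) *
        ((∑ w : Equiv.Perm (Fin n), (tHalf n ^ 2) ^ permLength w) * f) := by
    intro f hf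
    unfold one0
    rw [Finset.sum_mul, Finset.mul_sum]
    refine Finset.sum_congr rfl fun w _ => ?_
    rw [hT f hf w, sub_eq_add_neg, zpow_add₀ aux_t_ne, zpow_natCast]
    ring
  have hinv : ∀ (f : KK n) (i j : Fin n), (i : ℕ) + 1 = (j : ℕ) →
      sAct (Equiv.swap i j) (one0 Tw f) = one0 Tw f := by
    intro f i j hij
    let h : Equiv.Perm (Fin n) → KK n := fun w =>
      tHalf n ^ ((permLength w : ℤ) - (n * (n - 1) / 2 : ℕ)) * Tw w f
    have hasc : ∀ w, permLength (Equiv.swap i j * w) = permLength w + 1 →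
        sAct (Equiv.swap i j) (h w + h (Equiv.swap i j * w)) = h w + h (Equiv.swap i j * w) := by
      intro w hl
      have e : h w + h (Equiv.swap i j * w)
          = tHalf n ^ ((permLength w : ℤ) - (n * (n - 1) / 2 : ℕ)) *
            (Tw w f + tHalf n * heckeT i j (Tw w f)) := by
        simp only [h]
        rw [hTwmul w i j hij hl, Function.comp_apply, hl]
        have : ((permLength w + 1 : ℕ) : ℤ) - (n * (n - 1) / 2 : ℕ)
            = ((permLength w : ℤ) - (n * (n - 1) / 2 : ℕ)) + 1 := by push_cast; ring
        rw [this, zpow_add_one₀ aux_t_ne]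
        ring
      rw [e, map_mul, map_zpow₀, aux_sAct_t, aux_hecke_proj i j (hne i j hij)]
    have hall : ∀ w,
        sAct (Equiv.swap i j) (h w + h (Equiv.swap i j * w)) = h w + h (Equiv.swap i j * w) := by
      intro w
      rcases aux_length_dich w i j hij with hl | hl
      · exact hasc w hl
      · have := hasc (Equiv.swap i j * w) (by rw [aux_swap_swap]; exact hl)
        rw [aux_swap_swap] at this
        rw [add_comm]; exact this
    have h2 : (2 : KK n) * one0 Tw f = ∑ w, (h w + h (Equiv.swap i j * w)) := by
      have := Equiv.sum_comp (Equiv.mulLeft (Equiv.swap i j)) h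
      simp only [Equiv.coe_mulLeft] at this
      rw [Finset.sum_add_distrib, this, two_mul]
      rfl
    have h3 : (2 : KK n) * sAct (Equiv.swap i j) (one0 Tw f) = 2 * one0 Tw f := by
      have := congrArg (sAct (Equiv.swap i j)) h2
      rw [map_mul, map_sum, Finset.sum_congr rfl (fun w _ => hall w), ← h2] at this
      rwa [map_ofNat] at this
    exact mul_left_cancel₀ two_ne_zero h3
  have hTL : ∀ f ∈ LaurentSet n, ∀ w, Tw w f ∈ LaurentSet n := by
    intro f hf
    apply aux_perm_induction
    · rw [hTw1]; exact hf
    · intro w i j hij hl hw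
      rw [hTwmul w i j hij hl]
      exact aux_laurent_hecke i j (hne i j hij) hw
  refine ⟨?_, ?_, ?_, ?_⟩
  · intro f _ hf
    rw [hone f hf, ← aux_macdonald (tHalf n ^ 2) (aux_t_pow_ne 2 two_ne_zero) n xv aux_x_inj aux_x_ne]
    congr 1
    rw [Finset.sum_mul]
    refine Finset.sum_congr rfl fun w _ => ?_
    rw [map_mul, hf, mul_comm]
    congr 1
    rw [Finset.prod_filter, Fintype.prod_prod_type, map_prod]
    refine Finset.prod_congr rfl fun i _ => ?_
    rw [map_prod]
    refine Finset.prod_congr rfl fun j _ => ?_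
    split_ifs
    · simp only [map_div₀, map_sub, map_mul, map_pow, aux_sAct_x, aux_sAct_t]
    · simp
  · intro f i j hij
    exact (aux_hecke_symm i j (hne i j hij) _).2 (hinv f i j hij)
  · ext f
    refine and_congr_right fun _ => ⟨fun h => aux_symm_all f fun i j hij =>
      (aux_hecke_symm i j (hne i j hij) f).1 (h i j hij), fun h i j hij =>
      (aux_hecke_symm i j (hne i j hij) f).2 (h _)⟩
  · ext f
    constructor
    · rintro ⟨g, hg, rfl⟩
      refine ⟨?_, aux_symm_all _ (hinv g)⟩
      unfold one0
      refine aux_laurent_sum _ _ fun w _ => ?_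
      rw [aux_tpow]
      exact aux_laurent_polymul _ (hTL g hg w)
    · rintro ⟨hf, hs⟩
      obtain ⟨c, hc, hP⟩ := aux_poincare (n := n)
      have hcc : algebraMap (MvPolynomial (Fin n) (RatFunc ℚ)) (KK n) (C c) *
          algebraMap (MvPolynomial (Fin n) (RatFunc ℚ)) (KK n) (C c⁻¹) = 1 := by
        rw [← map_mul, ← C_mul, mul_inv_cancel₀ hc, C_1, map_one]
      refine ⟨algebraMap (MvPolynomial (Fin n) (RatFunc ℚ)) (KK n)
        (C (RatFunc.X ^ ((n * (n - 1) / 2 : ℕ) : ℤ)) * C c⁻¹) * f,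
        aux_laurent_polymul _ hf, ?_⟩
      rw [hone, hP, map_mul, ← aux_tpow]
      · have ht : tHalf n ^ (-(n * (n - 1) / 2 : ℕ) : ℤ) * tHalf n ^ ((n * (n - 1) / 2 : ℕ) : ℤ)
            = 1 := by
          rw [← zpow_add₀ aux_t_ne]; simp
        linear_combination (f * (tHalf n ^ (-(n * (n - 1) / 2 : ℕ) : ℤ) *
          tHalf n ^ ((n * (n - 1) / 2 : ℕ) : ℤ))) * hcc + f * ht
      · intro w
        rw [map_mul, hs, aux_sAct_alg, map_mul, rename_C, rename_C]

end
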